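/- In C = Cat(B) with the canonical 2-cell structure given by internal transformations, every internal natural transformation is a natural 2-cell, i.e. if (k,t,h) ∈ H(A,B) satisfies m⟨k_1, td⟩ = m⟨tc, h_1⟩, then (k,t,h) is natural with respect to every 2-cell (g,z,f) ∈ H(X,A) for every internal category X, that is, m⟨k_1 z, t f_0⟩ = m⟨t g_0, h_1 z⟩ for all such (g,z,f). -/

import Mathlib

open CategoryTheory

universe v u

variable {B : Type u} [Category.{v} B]

/-- An internal category in `B`: a system `(C₀, C₁, d, c, e, m)`, where the
object of composable pairs is a chosen pullback `P` of `d` along `c`, with the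
usual unit and associativity axioms (stated via generalized elements). -/
structure InternalCat (B : Type u) [Category.{v} B] where
  obj : B
  arr : B
  P : B
  d : arr ⟶ obj
  c : arr ⟶ obj
  e : obj ⟶ arr
  p1 : P ⟶ arr
  p2 : P ⟶ arr
  m : P ⟶ arr
  de : e ≫ d = 𝟙 obj
  ce : e ≫ c = 𝟙 obj
  pcomm : p1 ≫ d = p2 ≫ c
  lift : ∀ {Z : B} (u v : Z ⟶ arr), u ≫ d = v ≫ c → (Z ⟶ P)
  lift_p1 : ∀ {Z : B} (u v : Z ⟶ arr) (h : u ≫ d = v ≫ c), lift u v h ≫ p1 = u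
  lift_p2 : ∀ {Z : B} (u v : Z ⟶ arr) (h : u ≫ d = v ≫ c), lift u v h ≫ p2 = v
  lift_unique : ∀ {Z : B} (w w' : Z ⟶ P),
      w ≫ p1 = w' ≫ p1 → w ≫ p2 = w' ≫ p2 → w = w'
  md : m ≫ d = p2 ≫ d
  mc : m ≫ c = p1 ≫ c
  unit_left : ∀ {Z : B} (u : Z ⟶ arr) (h : ((u ≫ c) ≫ e) ≫ d = u ≫ c),
      lift ((u ≫ c) ≫ e) u h ≫ m = u
  unit_right : ∀ {Z : B} (u : Z ⟶ arr) (h : u ≫ d = ((u ≫ d) ≫ e) ≫ c),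
      lift u ((u ≫ d) ≫ e) h ≫ m = u
  massoc : ∀ {Z : B} (u v w : Z ⟶ arr) (h1 : u ≫ d = v ≫ c) (h2 : v ≫ d = w ≫ c)
      (h3 : u ≫ d = (lift v w h2 ≫ m) ≫ c) (h4 : (lift u v h1 ≫ m) ≫ d = w ≫ c),
      lift u (lift v w h2 ≫ m) h3 ≫ m = lift (lift u v h1 ≫ m) w h4 ≫ m

/-- An internal functor between internal categories in `B`. -/
structure InternalFunctor (A C : InternalCat B) where
  f0 : A.obj ⟶ C.obj
  f1 : A.arr ⟶ C.arr
  hd : f1 ≫ C.d = A.d ≫ f0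
  hc : f1 ≫ C.c = A.c ≫ f0
  he : A.e ≫ f1 = f0 ≫ C.e
  hm : ∀ {Z : B} (u v : Z ⟶ A.arr) (h : u ≫ A.d = v ≫ A.c)
      (h' : (u ≫ f1) ≫ C.d = (v ≫ f1) ≫ C.c),
      A.lift u v h ≫ A.m ≫ f1 = C.lift (u ≫ f1) (v ≫ f1) h' ≫ C.m

namespace InternalFunctor

theorem ext' {A C : InternalCat B} {F G : InternalFunctor A C}
    (h0 : F.f0 = G.f0) (h1 : F.f1 = G.f1) : F = G := by
  cases F; cases G; cases h0; cases h1; rfl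

/-- The identity internal functor. -/
def idF (A : InternalCat B) : InternalFunctor A A where
  f0 := 𝟙 _
  f1 := 𝟙 _
  hd := by simp
  hc := by simp
  he := by simp
  hm := fun u v h h' => by
    rw [show A.lift (u ≫ 𝟙 A.arr) (v ≫ 𝟙 A.arr) h' = A.lift u v h from
      A.lift_unique _ _ (by simp [A.lift_p1]) (by simp [A.lift_p2])]
    simp

/-- Composition of internal functors. -/
def compF {A C D : InternalCat B} (F : InternalFunctor A C)
    (G : InternalFunctor C D) : InternalFunctor A D where
  f0 := F.f0 ≫ G.f0
  f1 := F.f1 ≫ G.f1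
  hd := by
    rw [Category.assoc, G.hd, ← Category.assoc, F.hd, Category.assoc]
  hc := by
    rw [Category.assoc, G.hc, ← Category.assoc, F.hc, Category.assoc]
  he := by
    rw [← Category.assoc, F.he, Category.assoc, G.he, ← Category.assoc]
  hm := fun u v h h' => by
    have hF : (u ≫ F.f1) ≫ C.d = (v ≫ F.f1) ≫ C.c := by
      simp only [Category.assoc]
      rw [F.hd, F.hc, ← Category.assoc, ← Category.assoc, h]
    have hG : ((u ≫ F.f1) ≫ G.f1) ≫ D.d = ((v ≫ F.f1) ≫ G.f1) ≫ D.c := by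
      simp only [Category.assoc]
      rw [G.hd, G.hc, ← Category.assoc, ← Category.assoc, ← Category.assoc,
        ← Category.assoc, hF]
    have key : D.lift ((u ≫ F.f1) ≫ G.f1) ((v ≫ F.f1) ≫ G.f1) hG
        = D.lift (u ≫ F.f1 ≫ G.f1) (v ≫ F.f1 ≫ G.f1) h' :=
      D.lift_unique _ _
        (by rw [D.lift_p1, D.lift_p1, Category.assoc])
        (by rw [D.lift_p2, D.lift_p2, Category.assoc])
    calc A.lift u v h ≫ A.m ≫ F.f1 ≫ G.f1
        = (A.lift u v h ≫ A.m ≫ F.f1) ≫ G.f1 := by simp only [Category.assoc]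
      _ = (C.lift (u ≫ F.f1) (v ≫ F.f1) hF ≫ C.m) ≫ G.f1 := by
            rw [F.hm u v h hF]
      _ = C.lift (u ≫ F.f1) (v ≫ F.f1) hF ≫ C.m ≫ G.f1 := by
            simp only [Category.assoc]
      _ = D.lift ((u ≫ F.f1) ≫ G.f1) ((v ≫ F.f1) ≫ G.f1) hG ≫ D.m :=
            G.hm _ _ hF hG
      _ = D.lift (u ≫ F.f1 ≫ G.f1) (v ≫ F.f1 ≫ G.f1) h' ≫ D.m := by rw [key]

end InternalFunctor

/-- The category `Cat(B)` of internal categories in `B`. -/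
instance : Category (InternalCat B) where
  Hom := InternalFunctor
  id := InternalFunctor.idF
  comp F G := F.compF G
  id_comp F := by
    apply InternalFunctor.ext' <;>
      simp [InternalFunctor.compF, InternalFunctor.idF]
  comp_id F := by
    apply InternalFunctor.ext' <;>
      simp [InternalFunctor.compF, InternalFunctor.idF]
  assoc F G H := by
    apply InternalFunctor.ext' <;> simp [InternalFunctor.compF]

/-- An internal transformation (not necessarily natural) between internal
functors: a triple `(k, t, h)` with `dt = h₀`, `ct = k₀`. -/
structure Cell (A C : InternalCat B) where
  src : A ⟶ C
  trg : A ⟶ C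
  t : A.obj ⟶ C.arr
  td : t ≫ C.d = src.f0
  tc : t ≫ C.c = trg.f0

/- The elementary notion of a 2-cell structure. -/
structure TwoCellData (C : Type u) [Category.{v} C] where
  H : C → C → Type v
  dm : ∀ {A B : C}, H A B → (A ⟶ B)
  cd : ∀ {A B : C}, H A B → (A ⟶ B)
  zero : ∀ {A B : C}, (A ⟶ B) → H A B
  add : ∀ {A B : C} (x x' : H A B), dm x = cd x' → H A B
  actL : ∀ {A B B' : C}, (B ⟶ B') → H A B → H A B'
  actR : ∀ {A' A B : C}, H A B → (A' ⟶ A) → H A' B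

/-- `δ` is natural with respect to `z`:
`cod(δ)·z + δ·dom(z) = δ·cod(z) + dom(δ)·z`. -/
def TwoCellData.NatWrt {C : Type u} [Category.{v} C] (S : TwoCellData C)
    {X A B : C} (δ : S.H A B) (z : S.H X A) : Prop :=
  ∀ (h1 : S.dm (S.actL (S.cd δ) z) = S.cd (S.actR δ (S.dm z)))
    (h2 : S.dm (S.actR δ (S.cd z)) = S.cd (S.actL (S.dm δ) z)),
    S.add (S.actL (S.cd δ) z) (S.actR δ (S.dm z)) h1
      = S.add (S.actR δ (S.cd z)) (S.actL (S.dm δ) z) h2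

/-- The canonical 2-cell structure on `Cat(B)` given by internal
transformations (not necessarily natural). -/
def canonS (B : Type u) [Category.{v} B] : TwoCellData (InternalCat B) where
  H A C := Cell A C
  dm x := x.src
  cd x := x.trg
  zero {A C} f :=
    { src := f, trg := f, t := f.f0 ≫ C.e,
      td := by rw [Category.assoc, C.de, Category.comp_id]
      tc := by rw [Category.assoc, C.ce, Category.comp_id] }
  add {A C} x x' h :=
    { src := x'.src, trg := x.trg,
      t := C.lift x.t x'.t
        (by rw [x.td, x'.tc]; exact congrArg InternalFunctor.f0 h) ≫ C.m,
      td := by rw [Category.assoc, C.md, ← Category.assoc, C.lift_p2, x'.td]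
      tc := by rw [Category.assoc, C.mc, ← Category.assoc, C.lift_p1, x.tc] }
  actL {A C C'} g x :=
    { src := x.src ≫ g, trg := x.trg ≫ g, t := x.t ≫ g.f1,
      td := by rw [Category.assoc, g.hd, ← Category.assoc, x.td]; rfl
      tc := by rw [Category.assoc, g.hc, ← Category.assoc, x.tc]; rfl }
  actR {A' A C} x f :=
    { src := f ≫ x.src, trg := f ≫ x.trg, t := f.f0 ≫ x.t,
      td := by rw [Category.assoc, x.td]; rfl
      tc := by rw [Category.assoc, x.tc]; rfl }

/-- `τ = (k, t, h)` is an internal natural transformation: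
`m⟨k₁, td⟩ = m⟨tc, h₁⟩`. -/
def IsInternalNatural {A C : InternalCat B} (τ : Cell A C) : Prop :=
  ∀ (pf : τ.trg.f1 ≫ C.d = (A.d ≫ τ.t) ≫ C.c)
    (pf' : (A.c ≫ τ.t) ≫ C.d = τ.src.f1 ≫ C.c),
    C.lift τ.trg.f1 (A.d ≫ τ.t) pf ≫ C.m
      = C.lift (A.c ≫ τ.t) τ.src.f1 pf' ≫ C.m

/-- Precomposition distributes over the pairing into the object of composable pairs. -/
theorem InternalCat.comp_lift (C : InternalCat B) {Y Z : B} (w : Y ⟶ Z) (u v : Z ⟶ C.arr)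
    (h : u ≫ C.d = v ≫ C.c) (h' : (w ≫ u) ≫ C.d = (w ≫ v) ≫ C.c) :
    w ≫ C.lift u v h = C.lift (w ≫ u) (w ≫ v) h' :=
  C.lift_unique _ _
    (by rw [Category.assoc, C.lift_p1, C.lift_p1])
    (by rw [Category.assoc, C.lift_p2, C.lift_p2])

/-- Two cells with the same source, target and component are equal. -/
theorem Cell.eq_of_components {A C : InternalCat B} {x y : Cell A C}
    (hsrc : x.src = y.src) (htrg : x.trg = y.trg) (ht : x.t = y.t) : x = y := by
  cases x; cases y; cases hsrc; cases htrg; cases ht; rfl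

/-- The naturality square of an internal natural transformation at the generalized
element `z.t` of the object of arrows. -/
theorem IsInternalNatural.lift_comp_m_eq {X A C : InternalCat B} {τ : Cell A C}
    (hτ : IsInternalNatural τ) (z : Cell X A)
    (pf : (z.t ≫ τ.trg.f1) ≫ C.d = (z.src.f0 ≫ τ.t) ≫ C.c)
    (pf' : (z.trg.f0 ≫ τ.t) ≫ C.d = (z.t ≫ τ.src.f1) ≫ C.c) :
    C.lift (z.t ≫ τ.trg.f1) (z.src.f0 ≫ τ.t) pf ≫ C.m
      = C.lift (z.trg.f0 ≫ τ.t) (z.t ≫ τ.src.f1) pf' ≫ C.m := by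
  have hd : τ.trg.f1 ≫ C.d = (A.d ≫ τ.t) ≫ C.c := by
    rw [Category.assoc, τ.tc, τ.trg.hd]
  have hc : (A.c ≫ τ.t) ≫ C.d = τ.src.f1 ≫ C.c := by
    rw [Category.assoc, τ.td, τ.src.hc]
  have hsrc : z.src.f0 ≫ τ.t = z.t ≫ A.d ≫ τ.t := by
    rw [← z.td, Category.assoc]
  have htrg : z.trg.f0 ≫ τ.t = z.t ≫ A.c ≫ τ.t := by
    rw [← z.tc, Category.assoc]
  have key := congrArg (z.t ≫ ·) (hτ hd hc)
  simp only [← Category.assoc z.t (C.lift _ _ _)] at key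
  rw [C.comp_lift z.t _ _ hd (by rw [← hsrc]; exact pf),
    C.comp_lift z.t _ _ hc (by rw [← htrg]; exact pf')] at key
  simpa only [hsrc, htrg] using key

/-- In `Cat(B)` with the canonical 2-cell structure of
internal transformations, every internal natural transformation
`τ = (k,t,h)` (i.e. `m⟨k₁, td⟩ = m⟨tc, h₁⟩`) is a natural 2-cell: it is
natural with respect to every 2-cell `(g,z,f) ∈ H(X,A)`, i.e.
`m⟨k₁z, tf₀⟩ = m⟨tg₀, h₁z⟩` for all such `(g,z,f)`. -/
theorem internalNatural_is_natural
    {B : Type u} [Category.{v} B] (A C : InternalCat B)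
    (τ : (canonS B).H A C) (hτ : IsInternalNatural τ) :
    ∀ (X : InternalCat B) (z : (canonS B).H X A),
      (canonS B).NatWrt τ z ∧
      (∀ (pf : (z.t ≫ τ.trg.f1) ≫ C.d = (z.src.f0 ≫ τ.t) ≫ C.c)
         (pf' : (z.trg.f0 ≫ τ.t) ≫ C.d = (z.t ≫ τ.src.f1) ≫ C.c),
        C.lift (z.t ≫ τ.trg.f1) (z.src.f0 ≫ τ.t) pf ≫ C.m
          = C.lift (z.trg.f0 ≫ τ.t) (z.t ≫ τ.src.f1) pf' ≫ C.m) := by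
  intro X z
  refine ⟨fun h1 h2 => ?_, hτ.lift_comp_m_eq z⟩
  exact Cell.eq_of_components rfl rfl (hτ.lift_comp_m_eq z _ _)
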